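/- Let {X_n, n ≥ 1} be a strictly stationary sequence of associated random variables with |X_n| ≤ C_1 < ∞ for all n, and assume Σ_{j=n+1}^∞ Cov(X_1, X_j) = O(n^{−(k−2)/2}) for some natural number k > 2. Set S_n(x) = Σ_{j=1}^n (|X_j − x| − E|X_j − x|). Then there exists a constant B > 0, not depending on n or x, such that sup_{x ∈ [−C_1, C_1]} E|S_n(x)|^k ≤ B n^{k/2} for all n ≥ 1. -/

import Mathlib

open MeasureTheory ProbabilityTheory Filter Topology

noncomputable section

variable {Ω : Type*} [MeasurableSpace Ω]

/-- Covariance of two real-valued random variables. -/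
def cov (μ : Measure Ω) (f g : Ω → ℝ) : ℝ :=
  ∫ ω, f ω * g ω ∂μ - (∫ ω, f ω ∂μ) * (∫ ω, g ω ∂μ)

/-- A family of real-valued random variables is *associated* if every two coordinatewise
nondecreasing functions of any finite subcollection have nonnegative covariance
(whenever the relevant integrals exist). -/
def IsAssociated (μ : Measure Ω) {ι : Type*} (X : ι → Ω → ℝ) : Prop :=
  ∀ (S : Finset ι) (h g : (S → ℝ) → ℝ), Monotone h → Monotone g →
    Measurable h → Measurable g →
    Integrable (fun ω => h fun i => X i ω) μ →
    Integrable (fun ω => g fun i => X i ω) μ →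
    Integrable (fun ω => h (fun i => X i ω) * g (fun i => X i ω)) μ →
    0 ≤ cov μ (fun ω => h fun i => X i ω) (fun ω => g fun i => X i ω)

/-- Strict stationarity of the sequence `X 1, X 2, ...`. -/
def StrictStationary (μ : Measure Ω) (X : ℕ → Ω → ℝ) : Prop :=
  ∀ k n : ℕ, Measure.map (fun ω => fun i : Fin n => X (1 + (i : ℕ) + k) ω) μ =
    Measure.map (fun ω => fun i : Fin n => X (1 + (i : ℕ)) ω) μ

/-- Convergence in distribution to the standard normal law `N(0,1)`. -/
def TendstoStdGaussian (μ : Measure Ω) (Z : ℕ → Ω → ℝ) : Prop :=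
  ∀ f : BoundedContinuousFunction ℝ ℝ,
    Tendsto (fun n => ∫ ω, f (Z n ω) ∂μ) atTop
      (𝓝 (∫ x, f x ∂(gaussianReal 0 1)))

/-- The covariance of square integrable variables agrees with Mathlib's `covariance`. -/
lemma cov_eq_covariance {μ : Measure Ω} [IsProbabilityMeasure μ] {f g : Ω → ℝ}
    (hf : MemLp f 2 μ) (hg : MemLp g 2 μ) : cov μ f g = covariance f g μ := by
  rw [covariance_eq_sub hf hg]
  rfl

/-- Association for functions of the whole sequence that only depend on finitely many
coordinates. -/
lemma IsAssociated.covariance_nonneg {μ : Measure Ω} [IsProbabilityMeasure μ]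
    {X : ℕ → Ω → ℝ} (hassoc : IsAssociated μ X) (S : Finset ℕ) {F G : (ℕ → ℝ) → ℝ}
    (hF : Monotone F) (hG : Monotone G) (hFm : Measurable F) (hGm : Measurable G)
    (hFS : ∀ a b, (∀ j ∈ S, a j = b j) → F a = F b)
    (hGS : ∀ a b, (∀ j ∈ S, a j = b j) → G a = G b)
    (hFL : MemLp (fun ω => F fun j => X j ω) 2 μ)
    (hGL : MemLp (fun ω => G fun j => X j ω) 2 μ) :
    0 ≤ covariance (fun ω => F fun j => X j ω) (fun ω => G fun j => X j ω) μ := by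
  set e : (S → ℝ) → ℕ → ℝ := fun v j => if hj : j ∈ S then v ⟨j, hj⟩ else 0 with he
  have hem : Measurable e := by
    refine measurable_pi_lambda _ fun j => ?_
    by_cases hj : j ∈ S
    · simpa [he, hj] using measurable_pi_apply _
    · simp [he, hj]
  have hemono : Monotone e := by
    intro v w hvw j
    by_cases hj : j ∈ S
    · simpa [he, hj] using hvw _
    · simp [he, hj]
  have hFe : ∀ ω, F (e fun i => X i ω) = F fun j => X j ω :=
    fun ω => hFS _ _ fun j hj => by simp [he, hj]
  have hGe : ∀ ω, G (e fun i => X i ω) = G fun j => X j ω :=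
    fun ω => hGS _ _ fun j hj => by simp [he, hj]
  have h := hassoc S (F ∘ e) (G ∘ e) (hF.comp hemono) (hG.comp hemono) (hFm.comp hem)
    (hGm.comp hem)
  simp only [Function.comp_apply, hFe, hGe] at h
  rw [← cov_eq_covariance hFL hGL]
  exact h (hFL.integrable (by norm_num)) (hGL.integrable (by norm_num)) (hFL.integrable_mul hGL)

lemma memLp_two_of_abs_le {μ : Measure Ω} [IsProbabilityMeasure μ] {f : Ω → ℝ}
    (hf : Measurable f) (C : ℝ) (hC : ∀ ω, |f ω| ≤ C) : MemLp f 2 μ :=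
  MemLp.of_bound hf.aestronglyMeasurable C (ae_of_all _ hC)

lemma integrable_of_abs_le {μ : Measure Ω} [IsProbabilityMeasure μ] {f : Ω → ℝ}
    (hf : Measurable f) (C : ℝ) (hC : ∀ ω, |f ω| ≤ C) : Integrable f μ :=
  Integrable.of_bound hf.aestronglyMeasurable C (ae_of_all _ hC)

/-- Covariance comparison: functions of an associated bounded sequence that are Lipschitz in
finitely many coordinates have covariance dominated by that of the corresponding sums. -/
lemma IsAssociated.cov_le_of_lipschitz {μ : Measure Ω} [IsProbabilityMeasure μ]
    {X : ℕ → Ω → ℝ} (hassoc : IsAssociated μ X) (hmeas : ∀ j, Measurable (X j))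
    {C : ℝ} (hbdd : ∀ j ω, |X j ω| ≤ C) {F G : (ℕ → ℝ) → ℝ}
    (hFm : Measurable F) (hGm : Measurable G) (A B : Finset ℕ) {L L' : ℝ}
    (hL : 0 ≤ L) (hL' : 0 ≤ L')
    (hF : ∀ a b, |F a - F b| ≤ L * ∑ j ∈ A, |a j - b j|)
    (hG : ∀ a b, |G a - G b| ≤ L' * ∑ j ∈ B, |a j - b j|) :
    cov μ (fun ω => F fun j => X j ω) (fun ω => G fun j => X j ω) ≤
      L * L' * ∑ i ∈ A, ∑ j ∈ B, cov μ (X i) (X j) := by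
  have hXm : Measurable fun ω => fun j => X j ω := measurable_pi_lambda _ hmeas
  have hX2 : ∀ j, MemLp (X j) 2 μ := fun j => memLp_two_of_abs_le (hmeas j) C (hbdd j)
  have key : ∀ {H : (ℕ → ℝ) → ℝ} (_ : Measurable H) (D : Finset ℕ) {l : ℝ} (_ : 0 ≤ l)
      (_ : ∀ a b, |H a - H b| ≤ l * ∑ j ∈ D, |a j - b j|),
      MemLp (fun ω => H fun j => X j ω) 2 μ ∧
      (Monotone fun a => l * ∑ j ∈ D, a j + H a) ∧
      (Monotone fun a => l * ∑ j ∈ D, a j - H a) := by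
    intro H hHm D l hl hH
    refine ⟨memLp_two_of_abs_le (hHm.comp hXm) (|H 0| + l * ∑ j ∈ D, C) fun ω => ?_, ?_, ?_⟩
    · have h1 := hH (fun j => X j ω) 0
      have h2 : l * ∑ j ∈ D, |X j ω - (0 : ℕ → ℝ) j| ≤ l * ∑ j ∈ D, C := by
        gcongr with j
        simpa using hbdd j ω
      have h3 := abs_sub_abs_le_abs_sub (H fun j => X j ω) (H 0)
      linarith
    all_goals
      intro a b hab
      have h1 := hH b a
      have h2 : ∑ j ∈ D, |b j - a j| = ∑ j ∈ D, b j - ∑ j ∈ D, a j := by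
        rw [← Finset.sum_sub_distrib]
        exact Finset.sum_congr rfl fun j _ => abs_of_nonneg (sub_nonneg.2 (hab j))
      rw [h2, mul_sub] at h1
      have h3 := abs_le.1 h1
      simp only
      linarith [h3.1, h3.2]
  obtain ⟨hF2, hFp, hFn⟩ := key hFm A hL hF
  obtain ⟨hG2, hGp, hGn⟩ := key hGm B hL' hG
  have hFdep : ∀ a b : ℕ → ℝ, (∀ j ∈ A, a j = b j) → F a = F b := by
    intro a b hab
    have h := hF a b
    rw [Finset.sum_eq_zero fun j hj => by simp [hab j hj]] at h
    simpa [sub_eq_zero] using h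
  have hGdep : ∀ a b : ℕ → ℝ, (∀ j ∈ B, a j = b j) → G a = G b := by
    intro a b hab
    have h := hG a b
    rw [Finset.sum_eq_zero fun j hj => by simp [hab j hj]] at h
    simpa [sub_eq_zero] using h
  have hU2 : MemLp (fun ω => L * ∑ j ∈ A, X j ω) 2 μ :=
    (memLp_finsetSum A fun j _ => hX2 j).const_mul L
  have hV2 : MemLp (fun ω => L' * ∑ j ∈ B, X j ω) 2 μ :=
    (memLp_finsetSum B fun j _ => hX2 j).const_mul L'
  have hsA : ∀ a b : ℕ → ℝ, (∀ j ∈ A ∪ B, a j = b j) → ∑ j ∈ A, a j = ∑ j ∈ A, b j :=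
    fun a b h => Finset.sum_congr rfl fun j hj => h j (Finset.mem_union_left _ hj)
  have hsB : ∀ a b : ℕ → ℝ, (∀ j ∈ A ∪ B, a j = b j) → ∑ j ∈ B, a j = ∑ j ∈ B, b j :=
    fun a b h => Finset.sum_congr rfl fun j hj => h j (Finset.mem_union_right _ hj)
  have hsF : ∀ a b : ℕ → ℝ, (∀ j ∈ A ∪ B, a j = b j) → F a = F b :=
    fun a b h => hFdep a b fun j hj => h j (Finset.mem_union_left _ hj)
  have hsG : ∀ a b : ℕ → ℝ, (∀ j ∈ A ∪ B, a j = b j) → G a = G b :=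
    fun a b h => hGdep a b fun j hj => h j (Finset.mem_union_right _ hj)
  have hmA : Measurable fun a : ℕ → ℝ => L * ∑ j ∈ A, a j := by fun_prop
  have hmB : Measurable fun a : ℕ → ℝ => L' * ∑ j ∈ B, a j := by fun_prop
  set f : Ω → ℝ := fun ω => F fun j => X j ω
  set g : Ω → ℝ := fun ω => G fun j => X j ω
  set U : Ω → ℝ := fun ω => L * ∑ j ∈ A, X j ω with hU
  set V : Ω → ℝ := fun ω => L' * ∑ j ∈ B, X j ω with hV
  have h1 : 0 ≤ covariance (U + f) (V - g) μ :=
    hassoc.covariance_nonneg (A ∪ B) hFp hGn (hmA.add hFm) (hmB.sub hGm)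
      (fun a b h => by simp only [hsA a b h, hsF a b h])
      (fun a b h => by simp only [hsB a b h, hsG a b h]) (hU2.add hF2) (hV2.sub hG2)
  have h2 : 0 ≤ covariance (U - f) (V + g) μ :=
    hassoc.covariance_nonneg (A ∪ B) hFn hGp (hmA.sub hFm) (hmB.add hGm)
      (fun a b h => by simp only [hsA a b h, hsF a b h])
      (fun a b h => by simp only [hsB a b h, hsG a b h]) (hU2.sub hF2) (hV2.add hG2)
  rw [covariance_add_left hU2 hF2 (hV2.sub hG2), covariance_sub_right hU2 hV2 hG2,
    covariance_sub_right hF2 hV2 hG2] at h1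
  rw [covariance_sub_left hU2 hF2 (hV2.add hG2), covariance_add_right hU2 hV2 hG2,
    covariance_add_right hF2 hV2 hG2] at h2
  have h3 : covariance U V μ =
      L * L' * ∑ i ∈ A, ∑ j ∈ B, cov μ (X i) (X j) := by
    rw [hU, hV, covariance_const_mul_left, covariance_const_mul_right,
      covariance_fun_sum_fun_sum' (fun i _ => hX2 i) (fun j _ => hX2 j), mul_assoc]
    simp only [cov_eq_covariance (hX2 _) (hX2 _)]
  rw [cov_eq_covariance hF2 hG2]
  linarith

lemma exists_abs_add_pow_le (q : ℕ) :
    ∃ D : ℝ, 0 ≤ D ∧ ∀ s t : ℝ, |s + t| ^ q ≤ 6 / 5 * |s| ^ q + D * |t| ^ q := by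
  have hlim : Tendsto (fun η : ℝ => (1 + η) ^ q) (𝓝[>] 0) (𝓝 1) := by
    have h : Continuous fun η : ℝ => (1 + η) ^ q := by fun_prop
    simpa using (h.tendsto 0).mono_left nhdsWithin_le_nhds
  obtain ⟨η, hη, hη0⟩ := ((hlim.eventually (gt_mem_nhds (by norm_num : (1 : ℝ) < 6 / 5))).and
    self_mem_nhdsWithin).exists
  have hη0 : 0 < η := hη0
  refine ⟨(1 + 1 / η) ^ q, by positivity, fun s t => ?_⟩
  have hst := abs_add_le s t
  rcases le_total |t| (η * |s|) with h | h
  · calc |s + t| ^ q ≤ ((1 + η) * |s|) ^ q := by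
          gcongr
          linarith
      _ = (1 + η) ^ q * |s| ^ q := mul_pow _ _ _
      _ ≤ 6 / 5 * |s| ^ q := by gcongr
      _ ≤ _ := le_add_of_nonneg_right (by positivity)
  · have h' : |s| ≤ 1 / η * |t| := by
      rw [one_div, ← div_eq_inv_mul, le_div_iff₀ hη0]
      linarith
    calc |s + t| ^ q ≤ ((1 + 1 / η) * |t|) ^ q := by
          gcongr
          linarith
      _ = (1 + 1 / η) ^ q * |t| ^ q := mul_pow _ _ _
      _ ≤ _ := le_add_of_nonneg_left (by positivity)

/-- A family of bounded contractions `g j` such that each `g j (X j)` is centered. -/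
structure IsCenteredContraction (μ : Measure Ω) (X : ℕ → Ω → ℝ) (M : ℝ) (g : ℕ → ℝ → ℝ) :
    Prop where
  meas : ∀ j, Measurable (g j)
  lip : ∀ j a b, |g j a - g j b| ≤ |a - b|
  bdd : ∀ j a, |g j a| ≤ M
  mean : ∀ j, ∫ ω, g j (X j ω) ∂μ = 0

/-- The sum of `g j (X j)` over a block of indices. -/
def blockSum (X : ℕ → Ω → ℝ) (g : ℕ → ℝ → ℝ) (I : Finset ℕ) (ω : Ω) : ℝ :=
  ∑ j ∈ I, g j (X j ω)

/-- Moments of order `q` of block sums of length `n` are at most `b * n ^ (q / 2)`. -/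
def HasMomentBound (μ : Measure Ω) (X : ℕ → Ω → ℝ) (M : ℝ) (q : ℕ) (b : ℝ) : Prop :=
  ∀ g, IsCenteredContraction μ X M g → ∀ s n : ℕ,
    ∫ ω, |blockSum X g (Finset.Ico s (s + n)) ω| ^ q ∂μ ≤ b * √(n : ℝ) ^ q

section Blocks

variable {μ : Measure Ω} {X : ℕ → Ω → ℝ} {M : ℝ} {g : ℕ → ℝ → ℝ}

lemma measurable_blockSum (hmeas : ∀ j, Measurable (X j)) (hg : IsCenteredContraction μ X M g)
    (I : Finset ℕ) : Measurable (blockSum X g I) :=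
  Finset.measurable_fun_sum I fun j _ => (hg.meas j).comp (hmeas j)

lemma abs_sum_contraction_le (hg : IsCenteredContraction μ X M g) (I : Finset ℕ) (a : ℕ → ℝ) :
    |∑ j ∈ I, g j (a j)| ≤ M * I.card := by
  refine (Finset.abs_sum_le_sum_abs _ _).trans ?_
  refine (Finset.sum_le_sum fun j _ => hg.bdd j (a j)).trans ?_
  simp [mul_comm]

lemma abs_blockSum_le (hg : IsCenteredContraction μ X M g) (I : Finset ℕ) (ω : Ω) :
    |blockSum X g I ω| ≤ M * I.card :=
  abs_sum_contraction_le hg I fun j => X j ω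

lemma abs_sum_contraction_sub_le (hg : IsCenteredContraction μ X M g) (I : Finset ℕ)
    (a b : ℕ → ℝ) :
    |∑ j ∈ I, g j (a j) - ∑ j ∈ I, g j (b j)| ≤ ∑ j ∈ I, |a j - b j| := by
  rw [← Finset.sum_sub_distrib]
  exact (Finset.abs_sum_le_sum_abs _ _).trans (Finset.sum_le_sum fun j _ => hg.lip j _ _)

lemma abs_sum_contraction_pow_sub_le (hg : IsCenteredContraction μ X M g) (I : Finset ℕ)
    (i : ℕ) (a b : ℕ → ℝ) :
    |(|∑ j ∈ I, g j (a j)| ^ (i + 1) - |∑ j ∈ I, g j (b j)| ^ (i + 1))| ≤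
      ((i + 1) * (M * I.card) ^ i) * ∑ j ∈ I, |a j - b j| := by
  have h1 := abs_sum_contraction_le hg I a
  have h2 := abs_sum_contraction_le hg I b
  have h3 := (abs_abs_sub_abs_le _ _).trans (abs_sum_contraction_sub_le hg I a b)
  refine (abs_pow_sub_pow_le _ _ _).trans ?_
  rw [abs_abs, abs_abs, Nat.add_sub_cancel, mul_comm (((i : ℝ) + 1) * _), ← mul_assoc]
  push_cast
  have h4 := (abs_nonneg _).trans h1
  gcongr
  exact max_le h1 h2

variable [IsProbabilityMeasure μ]

lemma integrable_blockSum_pow_mul_pow (hmeas : ∀ j, Measurable (X j))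
    (hg : IsCenteredContraction μ X M g) (A B : Finset ℕ) (i l : ℕ) :
    Integrable (fun ω => |blockSum X g A ω| ^ i * |blockSum X g B ω| ^ l) μ := by
  have hA := measurable_blockSum hmeas hg A
  have hB := measurable_blockSum hmeas hg B
  refine integrable_of_abs_le (by fun_prop) ((M * A.card) ^ i * (M * B.card) ^ l) fun ω => ?_
  have h1 := abs_blockSum_le hg A ω
  have h2 := abs_blockSum_le hg B ω
  have h3 : 0 ≤ M * A.card := (abs_nonneg _).trans h1
  rw [abs_mul, abs_pow, abs_pow, abs_abs, abs_abs]
  gcongr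

lemma integrable_blockSum_pow (hmeas : ∀ j, Measurable (X j))
    (hg : IsCenteredContraction μ X M g) (A : Finset ℕ) (i : ℕ) :
    Integrable (fun ω => |blockSum X g A ω| ^ i) μ := by
  simpa using integrable_blockSum_pow_mul_pow hmeas hg A ∅ i 0

/-- Mixed moments of two block sums factorize up to the covariances between the blocks. -/
lemma integral_blockSum_pow_mul_pow_le (hassoc : IsAssociated μ X)
    (hmeas : ∀ j, Measurable (X j)) {C : ℝ} (hbdd : ∀ j ω, |X j ω| ≤ C) (hM : 0 ≤ M)
    (hg : IsCenteredContraction μ X M g) (A B : Finset ℕ) (i l : ℕ) :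
    ∫ ω, |blockSum X g A ω| ^ (i + 1) * |blockSum X g B ω| ^ (l + 1) ∂μ ≤
      (∫ ω, |blockSum X g A ω| ^ (i + 1) ∂μ) * (∫ ω, |blockSum X g B ω| ^ (l + 1) ∂μ) +
      ((i + 1) * (M * A.card) ^ i) * ((l + 1) * (M * B.card) ^ l) *
        ∑ a ∈ A, ∑ b ∈ B, cov μ (X a) (X b) := by
  have hm : ∀ (I : Finset ℕ) (n : ℕ),
      Measurable fun a : ℕ → ℝ => |∑ j ∈ I, g j (a j)| ^ n := fun I n =>
    ((Finset.measurable_fun_sum I fun j _ =>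
      (hg.meas j).comp (measurable_pi_apply j)).norm).pow_const n
  have h := hassoc.cov_le_of_lipschitz hmeas hbdd (hm A (i + 1)) (hm B (l + 1)) A B
    (by positivity) (by positivity) (abs_sum_contraction_pow_sub_le hg A i)
    (abs_sum_contraction_pow_sub_le hg B l)
  simp only [cov] at h ⊢
  simp only [blockSum]
  linarith

/-- Second moments of block sums are dominated by the covariances of `X`. -/
lemma integral_blockSum_sq_le (hassoc : IsAssociated μ X)
    (hmeas : ∀ j, Measurable (X j)) {C : ℝ} (hbdd : ∀ j ω, |X j ω| ≤ C)
    (hg : IsCenteredContraction μ X M g) (A : Finset ℕ) :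
    ∫ ω, |blockSum X g A ω| ^ 2 ∂μ ≤ ∑ a ∈ A, ∑ b ∈ A, cov μ (X a) (X b) := by
  have hm : Measurable fun a : ℕ → ℝ => ∑ j ∈ A, g j (a j) :=
    Finset.measurable_fun_sum A fun j _ => (hg.meas j).comp (measurable_pi_apply j)
  have h := hassoc.cov_le_of_lipschitz hmeas hbdd hm hm A A zero_le_one zero_le_one
    (fun a b => by simpa using abs_sum_contraction_sub_le hg A a b)
    (fun a b => by simpa using abs_sum_contraction_sub_le hg A a b)
  have h0 : ∫ ω, ∑ j ∈ A, g j (X j ω) ∂μ = 0 := by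
    have hi : ∀ j ∈ A, Integrable (fun ω => g j (X j ω)) μ := fun j _ =>
      integrable_of_abs_le ((hg.meas j).comp (hmeas j)) M fun ω => hg.bdd j _
    rw [integral_finsetSum _ hi]
    exact Finset.sum_eq_zero fun j _ => hg.mean j
  rw [cov, h0] at h
  simpa [blockSum, sq] using h

lemma hasMomentBound_zero : HasMomentBound μ X M 0 1 := fun g _ s n => by simp

lemma hasMomentBound_two (hassoc : IsAssociated μ X)
    (hmeas : ∀ j, Measurable (X j)) {C : ℝ} (hbdd : ∀ j ω, |X j ω| ≤ C) {V : ℝ}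
    (hV : ∀ (i : ℕ) (J : Finset ℕ), ∑ j ∈ J, cov μ (X i) (X j) ≤ V) :
    HasMomentBound μ X M 2 V := fun g hg s n => by
  refine (integral_blockSum_sq_le hassoc hmeas hbdd hg _).trans ?_
  refine (Finset.sum_le_sum fun i _ => hV i _).trans ?_
  rw [Real.sq_sqrt (Nat.cast_nonneg n)]
  simp [mul_comm]

lemma HasMomentBound.one_of_two (hmeas : ∀ j, Measurable (X j)) {b : ℝ}
    (h : HasMomentBound μ X M 2 b) : HasMomentBound μ X M 1 ((1 + b) / 2) := fun g hg s n => by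
  rcases Nat.eq_zero_or_pos n with rfl | hn
  · simp [blockSum]
  have hr : 0 < √(n : ℝ) := Real.sqrt_pos.2 (by exact_mod_cast hn)
  have h2 := h g hg s n
  set S := blockSum X g (Finset.Ico s (s + n))
  have hi : Integrable (fun ω => |S ω| ^ 2) μ := integrable_blockSum_pow hmeas hg _ 2
  have hi1 : Integrable (fun ω => |S ω| ^ 1) μ := integrable_blockSum_pow hmeas hg _ 1
  calc ∫ ω, |S ω| ^ 1 ∂μ ≤ ∫ ω, (√(n : ℝ) / 2 + (1 / (2 * √(n : ℝ))) * |S ω| ^ 2) ∂μ := by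
        refine integral_mono hi1 ((integrable_const _).add (hi.const_mul _)) fun ω => ?_
        have e : √(n : ℝ) / 2 + (1 / (2 * √(n : ℝ))) * |S ω| ^ 2 - |S ω| ^ 1 =
            (√(n : ℝ) - |S ω|) ^ 2 / (2 * √(n : ℝ)) := by
          field_simp
          ring
        have := div_nonneg (sq_nonneg (√(n : ℝ) - |S ω|)) (by positivity : 0 ≤ 2 * √(n : ℝ))
        simp only
        linarith
    _ = √(n : ℝ) / 2 + (1 / (2 * √(n : ℝ))) * ∫ ω, |S ω| ^ 2 ∂μ := by
        rw [integral_add (integrable_const _) (hi.const_mul _), integral_const_mul]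
        simp
    _ ≤ √(n : ℝ) / 2 + (1 / (2 * √(n : ℝ))) * (b * √(n : ℝ) ^ 2) := by gcongr
    _ = (1 + b) / 2 * √(n : ℝ) ^ 1 := by
        field_simp

/-- Mixed moments of two comparable blocks separated by a gap of comparable length. -/
lemma integral_separated_blocks_le (hassoc : IsAssociated μ X)
    (hmeas : ∀ j, Measurable (X j)) {C : ℝ} (hbdd : ∀ j ω, |X j ω| ≤ C) (hM : 0 ≤ M)
    (hg : IsCenteredContraction μ X M g) (hc0 : ∀ i j, 0 ≤ cov μ (X i) (X j)) {i l : ℕ}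
    {K : ℝ} (hK0 : 0 ≤ K)
    (hK : ∀ (a p : ℕ) (J : Finset ℕ), 1 ≤ p → (∀ j ∈ J, a + p ≤ j) →
      √(p : ℝ) ^ (i + l) * ∑ j ∈ J, cov μ (X a) (X j) ≤ K)
    {b b' : ℝ} (hb : 0 ≤ b) (hb' : 0 ≤ b') (h : HasMomentBound μ X M (i + 1) b)
    (h' : HasMomentBound μ X M (l + 1) b') {R : ℝ} {s n p t n' m : ℕ} (hp : 1 ≤ p)
    (hst : s + n + p ≤ t) (hn : n ≤ m) (hn' : n' ≤ m) (hR : (m : ℝ) ≤ R * p) :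
    ∫ ω, |blockSum X g (Finset.Ico s (s + n)) ω| ^ (i + 1) *
        |blockSum X g (Finset.Ico t (t + n')) ω| ^ (l + 1) ∂μ ≤
      (b * b' + (i + 1) * (l + 1) * M ^ (i + l) * K * √R ^ (i + l)) *
        √(m : ℝ) ^ (i + l + 2) := by
  refine (integral_blockSum_pow_mul_pow_le hassoc hmeas hbdd hM hg _ _ i l).trans ?_
  have h1 := h g hg s n
  have h2 := h' g hg t n'
  have hnm : √(n : ℝ) ≤ √(m : ℝ) := Real.sqrt_le_sqrt (by exact_mod_cast hn)
  have hnm' : √(n' : ℝ) ≤ √(m : ℝ) := Real.sqrt_le_sqrt (by exact_mod_cast hn')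
  have hprod : (∫ ω, |blockSum X g (Finset.Ico s (s + n)) ω| ^ (i + 1) ∂μ) *
      (∫ ω, |blockSum X g (Finset.Ico t (t + n')) ω| ^ (l + 1) ∂μ) ≤
      b * b' * √(m : ℝ) ^ (i + l + 2) := by
    calc _ ≤ (b * √(n : ℝ) ^ (i + 1)) * (b' * √(n' : ℝ) ^ (l + 1)) :=
          mul_le_mul h1 h2 (integral_nonneg fun ω => by positivity) (by positivity)
      _ ≤ (b * √(m : ℝ) ^ (i + 1)) * (b' * √(m : ℝ) ^ (l + 1)) := by gcongr
      _ = _ := by ring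
  have hp0 : 0 < (p : ℝ) := by exact_mod_cast hp
  have hR0 : 0 ≤ R := nonneg_of_mul_nonneg_left ((Nat.cast_nonneg m).trans hR) hp0
  have hmp : √(m : ℝ) ≤ √R * √(p : ℝ) := by
    rw [← Real.sqrt_mul hR0]
    exact Real.sqrt_le_sqrt hR
  set W := ∑ a ∈ Finset.Ico s (s + n), ∑ b ∈ Finset.Ico t (t + n'), cov μ (X a) (X b) with hW
  have hW0 : 0 ≤ W := Finset.sum_nonneg fun _ _ => Finset.sum_nonneg fun _ _ => hc0 _ _
  have hWK : √(p : ℝ) ^ (i + l) * W ≤ m * K := by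
    rw [hW, Finset.mul_sum]
    calc _ ≤ ∑ a ∈ Finset.Ico s (s + n), K := Finset.sum_le_sum fun a ha =>
          hK a p _ hp fun j hj => by
            rw [Finset.mem_Ico] at ha hj
            omega
      _ = n * K := by simp
      _ ≤ m * K := by gcongr
  have hcov : ((i + 1) * (M * (Finset.Ico s (s + n)).card) ^ i) *
      ((l + 1) * (M * (Finset.Ico t (t + n')).card) ^ l) * W ≤
      (i + 1) * (l + 1) * M ^ (i + l) * K * √R ^ (i + l) * √(m : ℝ) ^ (i + l + 2) := by
    simp only [Nat.card_Ico, Nat.add_sub_cancel_left]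
    have hms : √(m : ℝ) * √(m : ℝ) = m := Real.mul_self_sqrt (Nat.cast_nonneg m)
    calc _ ≤ ((i + 1) * (M * (m : ℝ)) ^ i) * ((l + 1) * (M * (m : ℝ)) ^ l) * W := by gcongr
      _ = (i + 1) * (l + 1) * M ^ (i + l) * √(m : ℝ) ^ (i + l) * (√(m : ℝ) ^ (i + l) * W) := by
          conv_lhs => rw [← hms]
          ring
      _ ≤ (i + 1) * (l + 1) * M ^ (i + l) * √(m : ℝ) ^ (i + l) *
          ((√R * √(p : ℝ)) ^ (i + l) * W) := by gcongr
      _ = (i + 1) * (l + 1) * M ^ (i + l) * √(m : ℝ) ^ (i + l) * √R ^ (i + l) *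
          (√(p : ℝ) ^ (i + l) * W) := by ring
      _ ≤ (i + 1) * (l + 1) * M ^ (i + l) * √(m : ℝ) ^ (i + l) * √R ^ (i + l) * (m * K) := by
          gcongr
      _ = _ := by
          rw [show (m : ℝ) * K = √(m : ℝ) * √(m : ℝ) * K by rw [hms]]
          ring
  linarith

/-- Moments of the sum of two separated comparable blocks. -/
lemma exists_integral_add_separated_blocks_le (hassoc : IsAssociated μ X)
    (hmeas : ∀ j, Measurable (X j)) {C : ℝ} (hbdd : ∀ j ω, |X j ω| ≤ C) (hM : 0 ≤ M)
    (hc0 : ∀ i j, 0 ≤ cov μ (X i) (X j)) {r : ℕ} {K : ℝ} (hK0 : 0 ≤ K)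
    (hK : ∀ (a p : ℕ) (J : Finset ℕ), 1 ≤ p → (∀ j ∈ J, a + p ≤ j) →
      √(p : ℝ) ^ r * ∑ j ∈ J, cov μ (X a) (X j) ≤ K)
    (hlow : ∀ i < r + 2, ∃ b, 0 ≤ b ∧ HasMomentBound μ X M i b) (R : ℝ) :
    ∃ c, 0 ≤ c ∧ ∀ g, IsCenteredContraction μ X M g → ∀ s n p t n' m : ℕ, 1 ≤ p →
      s + n + p ≤ t → n ≤ m → n' ≤ m → (m : ℝ) ≤ R * p →
      ∫ ω, |blockSum X g (Finset.Ico s (s + n)) ω +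
          blockSum X g (Finset.Ico t (t + n')) ω| ^ (r + 2) ∂μ ≤
        ∫ ω, |blockSum X g (Finset.Ico s (s + n)) ω| ^ (r + 2) ∂μ +
        ∫ ω, |blockSum X g (Finset.Ico t (t + n')) ω| ^ (r + 2) ∂μ +
        c * √(m : ℝ) ^ (r + 2) := by
  choose! b hb0 hb using hlow
  have hmix : ∀ i ∈ Finset.range (r + 1), ∃ d : ℝ, 0 ≤ d ∧
      ∀ g, IsCenteredContraction μ X M g → ∀ s n p t n' m : ℕ, 1 ≤ p →
      s + n + p ≤ t → n ≤ m → n' ≤ m → (m : ℝ) ≤ R * p →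
      ∫ ω, |blockSum X g (Finset.Ico s (s + n)) ω| ^ (i + 1) *
        |blockSum X g (Finset.Ico t (t + n')) ω| ^ (r + 2 - (i + 1)) ∂μ ≤
        d * √(m : ℝ) ^ (r + 2) := by
    intro i hi
    obtain ⟨l, rfl⟩ := Nat.exists_eq_add_of_le (Nat.lt_succ_iff.1 (Finset.mem_range.1 hi))
    have hi2 : i + 1 < i + l + 2 := by omega
    have hl2 : l + 1 < i + l + 2 := by omega
    have hbi := hb0 _ hi2
    have hbl := hb0 _ hl2
    refine ⟨b (i + 1) * b (l + 1) + (i + 1) * (l + 1) * M ^ (i + l) * K * √R ^ (i + l),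
      by positivity, fun g hg s n p t n' m hp hst hn hn' hR => ?_⟩
    rw [show i + l + 2 - (i + 1) = l + 1 by omega]
    exact integral_separated_blocks_le hassoc hmeas hbdd hM hg hc0 hK0 hK hbi hbl
      (hb _ hi2) (hb _ hl2) hp hst hn hn' hR
  choose! d hd0 hd using hmix
  refine ⟨∑ i ∈ Finset.range (r + 1), d i * ((r + 2).choose (i + 1) : ℝ),
    Finset.sum_nonneg fun i hi => mul_nonneg (hd0 i hi) (Nat.cast_nonneg _),
    fun g hg s n p t n' m hp hst hn hn' hR => ?_⟩
  set A := Finset.Ico s (s + n)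
  set B := Finset.Ico t (t + n')
  have hsum : ∀ ω, (|blockSum X g A ω| + |blockSum X g B ω|) ^ (r + 2) =
      |blockSum X g A ω| ^ (r + 2) + |blockSum X g B ω| ^ (r + 2) +
      ∑ i ∈ Finset.range (r + 1), (|blockSum X g A ω| ^ (i + 1) *
        |blockSum X g B ω| ^ (r + 2 - (i + 1))) * ((r + 2).choose (i + 1) : ℝ) := by
    intro ω
    rw [add_pow, Finset.sum_range_succ, Finset.sum_range_succ']
    simp
    ring
  have hiA := integrable_blockSum_pow hmeas hg A (r + 2)
  have hiB := integrable_blockSum_pow hmeas hg B (r + 2)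
  have hiM : ∀ i ∈ Finset.range (r + 1), Integrable (fun ω => (|blockSum X g A ω| ^ (i + 1) *
        |blockSum X g B ω| ^ (r + 2 - (i + 1))) * ((r + 2).choose (i + 1) : ℝ)) μ := fun i _ =>
    (integrable_blockSum_pow_mul_pow hmeas hg A B _ _).mul_const _
  calc _ ≤ ∫ ω, (|blockSum X g A ω| ^ (r + 2) + |blockSum X g B ω| ^ (r + 2) +
      ∑ i ∈ Finset.range (r + 1), (|blockSum X g A ω| ^ (i + 1) *
        |blockSum X g B ω| ^ (r + 2 - (i + 1))) * ((r + 2).choose (i + 1) : ℝ)) ∂μ := by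
        refine integral_mono_of_nonneg (ae_of_all _ fun ω => by positivity)
          ((hiA.add hiB).add (integrable_finsetSum _ hiM)) (ae_of_all _ fun ω => ?_)
        simp only
        rw [← hsum]
        gcongr
        exact abs_add_le _ _
    _ = ∫ ω, |blockSum X g A ω| ^ (r + 2) ∂μ + ∫ ω, |blockSum X g B ω| ^ (r + 2) ∂μ +
        ∑ i ∈ Finset.range (r + 1), (∫ ω, |blockSum X g A ω| ^ (i + 1) *
          |blockSum X g B ω| ^ (r + 2 - (i + 1)) ∂μ) * ((r + 2).choose (i + 1) : ℝ) := by
        have hAB : Integrable (fun ω => |blockSum X g A ω| ^ (r + 2) +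
            |blockSum X g B ω| ^ (r + 2)) μ := hiA.add hiB
        rw [integral_add hAB (integrable_finsetSum _ hiM), integral_add hiA hiB,
          integral_finsetSum _ hiM]
        simp only [integral_mul_const]
    _ ≤ _ := by
        rw [Finset.sum_mul]
        refine add_le_add le_rfl (Finset.sum_le_sum fun i hi => ?_)
        rw [mul_right_comm]
        gcongr
        exact hd i hi g hg s n p t n' m hp hst hn hn' hR

/-- Bounds on all lower moments and critical covariance decay propagate to the next moment, by
splitting a block into two halves separated by a short proportional gap. -/
lemma HasMomentBound.exists_add_two (hassoc : IsAssociated μ X)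
    (hmeas : ∀ j, Measurable (X j)) {C : ℝ} (hbdd : ∀ j ω, |X j ω| ≤ C) (hM : 0 ≤ M)
    (hc0 : ∀ i j, 0 ≤ cov μ (X i) (X j)) {r : ℕ} (hr : 1 ≤ r) {K : ℝ} (hK0 : 0 ≤ K)
    (hK : ∀ (a p : ℕ) (J : Finset ℕ), 1 ≤ p → (∀ j ∈ J, a + p ≤ j) →
      √(p : ℝ) ^ r * ∑ j ∈ J, cov μ (X a) (X j) ≤ K)
    (hlow : ∀ i < r + 2, ∃ b, 0 ≤ b ∧ HasMomentBound μ X M i b) :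
    ∃ b, 0 ≤ b ∧ HasMomentBound μ X M (r + 2) b := by
  obtain ⟨D, hD0, hD⟩ := exists_abs_add_pow_le (r + 2)
  obtain ⟨T, hT⟩ := exists_nat_gt (20 * D + 1)
  have hT1 : (1 : ℝ) ≤ T := by linarith
  have hT1' : 1 < T := by exact_mod_cast (by linarith : (1 : ℝ) < T)
  obtain ⟨c, hc, hadd⟩ := exists_integral_add_separated_blocks_le hassoc hmeas hbdd hM hc0
    hK0 hK hlow (2 * T ^ 2)
  set a := 20 * c + (M * T ^ 2) ^ (r + 2) with ha
  have ha0 : 0 ≤ a := by positivity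
  refine ⟨a, ha0, fun g hg s m => ?_⟩
  induction m using Nat.strong_induction_on generalizing s with
  | _ m ih =>
  rcases lt_or_ge m (T ^ 2) with hmT | hmT
  · have hle : ∀ ω, |blockSum X g (Finset.Ico s (s + m)) ω| ^ (r + 2) ≤
        a * √(m : ℝ) ^ (r + 2) := by
      intro ω
      rcases Nat.eq_zero_or_pos m with rfl | hm0
      · simp [blockSum]
      have h1 : (1 : ℝ) ≤ √(m : ℝ) := Real.one_le_sqrt.2 (by exact_mod_cast hm0)
      have h2 := abs_blockSum_le hg (Finset.Ico s (s + m)) ω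
      rw [Nat.card_Ico, Nat.add_sub_cancel_left] at h2
      have h3 : (m : ℝ) ≤ T ^ 2 := by exact_mod_cast hmT.le
      calc |blockSum X g (Finset.Ico s (s + m)) ω| ^ (r + 2) ≤ (M * T ^ 2) ^ (r + 2) := by
            gcongr
            exact h2.trans (by gcongr)
        _ ≤ a := by linarith
        _ ≤ a * √(m : ℝ) ^ (r + 2) := le_mul_of_one_le_right ha0 (one_le_pow₀ h1)
    calc _ ≤ ∫ _, a * √(m : ℝ) ^ (r + 2) ∂μ :=
          integral_mono (integrable_blockSum_pow hmeas hg _ _) (integrable_const _) hle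
      _ = _ := by simp
  have hTT : 0 < T ^ 2 := by positivity
  obtain ⟨p, hp⟩ : ∃ p, p = m / T ^ 2 := ⟨_, rfl⟩
  have hp1 : 1 ≤ p := hp ▸ (Nat.one_le_div_iff hTT).2 hmT
  have hpm : p * T ^ 2 ≤ m := hp ▸ Nat.div_mul_le_self m _
  have hmp : m < (p + 1) * T ^ 2 := by
    rw [hp, mul_comm]
    exact Nat.lt_mul_div_succ m hTT
  have hpm' : p < m := hp ▸ Nat.div_lt_self (hTT.trans_le hmT) (Nat.one_lt_pow two_ne_zero hT1')
  obtain ⟨n, hn⟩ : ∃ n, n = (m - p) / 2 := ⟨_, rfl⟩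
  obtain ⟨n', hn'⟩ : ∃ n', n' = m - p - n := ⟨_, rfl⟩
  have hn2 : 2 * n ≤ m := by omega
  have hn2' : 2 * n' ≤ m := by omega
  have hm0 : 0 < m := by omega
  set A := blockSum X g (Finset.Ico s (s + n)) with hA
  set G := blockSum X g (Finset.Ico (s + n) (s + n + p)) with hG
  set B := blockSum X g (Finset.Ico (s + n + p) (s + n + p + n')) with hB
  have hsplit : ∀ ω, blockSum X g (Finset.Ico s (s + m)) ω = (A ω + B ω) + G ω := by
    intro ω
    rw [show s + m = s + n + p + n' by omega, hA, hB, hG]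
    simp only [blockSum]
    rw [← Finset.sum_Ico_consecutive _ (show s ≤ s + n by omega)
        (show s + n ≤ s + n + p + n' by omega),
      ← Finset.sum_Ico_consecutive _ (show s + n ≤ s + n + p by omega)
        (show s + n + p ≤ s + n + p + n' by omega)]
    ring
  have hR : (m : ℝ) ≤ 2 * (T : ℝ) ^ 2 * p := by
    have h : m ≤ 2 * T ^ 2 * p := by nlinarith
    exact_mod_cast h
  have hAB := hadd g hg s n p (s + n + p) n' m hp1 le_rfl (by omega) (by omega) hR
  have hmA := measurable_blockSum hmeas hg (Finset.Ico s (s + n))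
  have hmB := measurable_blockSum hmeas hg (Finset.Ico (s + n + p) (s + n + p + n'))
  have hiAB : Integrable (fun ω => |A ω + B ω| ^ (r + 2)) μ := by
    refine integrable_of_abs_le (by fun_prop)
      ((M * (Finset.Ico s (s + n)).card +
        M * (Finset.Ico (s + n + p) (s + n + p + n')).card) ^ (r + 2)) fun ω => ?_
    rw [abs_pow, abs_abs]
    gcongr
    exact (abs_add_le _ _).trans (add_le_add (abs_blockSum_le hg _ ω) (abs_blockSum_le hg _ ω))
  have hiG : Integrable (fun ω => |G ω| ^ (r + 2)) μ := integrable_blockSum_pow hmeas hg _ _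
  have hmain : ∫ ω, |blockSum X g (Finset.Ico s (s + m)) ω| ^ (r + 2) ∂μ ≤
      6 / 5 * ∫ ω, |A ω + B ω| ^ (r + 2) ∂μ + D * ∫ ω, |G ω| ^ (r + 2) ∂μ := by
    rw [← integral_const_mul, ← integral_const_mul,
      ← integral_add (hiAB.const_mul _) (hiG.const_mul _)]
    refine integral_mono (integrable_blockSum_pow hmeas hg _ _)
      ((hiAB.const_mul _).add (hiG.const_mul _)) fun ω => ?_
    simp only [hsplit]
    exact hD _ _
  have hhalf : ∀ u : ℕ, 2 * u ≤ m →
      √(u : ℝ) ^ (r + 2) ≤ 9 / 25 * √(m : ℝ) ^ (r + 2) := by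
    intro u hu
    have hu' : 2 * (u : ℝ) ≤ m := by exact_mod_cast hu
    have h1 : √(u : ℝ) ≤ 0.71 * √(m : ℝ) := by
      rw [show (0.71 : ℝ) = √(0.71 ^ 2) by rw [Real.sqrt_sq (by norm_num)],
        ← Real.sqrt_mul (by norm_num)]
      refine Real.sqrt_le_sqrt ?_
      nlinarith
    calc √(u : ℝ) ^ (r + 2) ≤ (0.71 * √(m : ℝ)) ^ (r + 2) := by gcongr
      _ = 0.71 ^ (r + 2) * √(m : ℝ) ^ (r + 2) := mul_pow _ _ _
      _ ≤ 0.71 ^ 3 * √(m : ℝ) ^ (r + 2) := by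
          gcongr ?_ * _
          exact pow_le_pow_of_le_one (by norm_num) (by norm_num) (by omega)
      _ ≤ _ := by
          gcongr
          norm_num
  have hgap : D * √(p : ℝ) ^ (r + 2) ≤ 1 / 20 * √(m : ℝ) ^ (r + 2) := by
    have h1 : T * √(p : ℝ) ≤ √(m : ℝ) := by
      refine Real.le_sqrt_of_sq_le ?_
      rw [mul_pow, Real.sq_sqrt (Nat.cast_nonneg p), mul_comm]
      exact_mod_cast hpm
    calc D * √(p : ℝ) ^ (r + 2) ≤ 1 / 20 * T * √(p : ℝ) ^ (r + 2) := by
          gcongr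
          linarith
      _ ≤ 1 / 20 * T ^ (r + 2) * √(p : ℝ) ^ (r + 2) := by
          gcongr
          exact le_self_pow₀ hT1 (by omega)
      _ = 1 / 20 * (T * √(p : ℝ)) ^ (r + 2) := by ring
      _ ≤ _ := by gcongr
  have hA1 := ih n (by omega) s
  have hB1 := ih n' (by omega) (s + n + p)
  have hG1 := mul_le_mul_of_nonneg_left (ih p hpm' (s + n)) hD0
  have hA2 := mul_le_mul_of_nonneg_left (hhalf n hn2) ha0
  have hB2 := mul_le_mul_of_nonneg_left (hhalf n' hn2') ha0
  have hG2 := mul_le_mul_of_nonneg_left hgap ha0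
  have hca : 20 * c * √(m : ℝ) ^ (r + 2) ≤ a * √(m : ℝ) ^ (r + 2) := by
    have : 0 ≤ (M * (T : ℝ) ^ 2) ^ (r + 2) := by positivity
    gcongr
    linarith
  have hc1 : 0 ≤ c * √(m : ℝ) ^ (r + 2) := by positivity
  linarith

/-- Moment bounds of every order up to `k` under the critical covariance decay. -/
lemma exists_hasMomentBound (hassoc : IsAssociated μ X)
    (hmeas : ∀ j, Measurable (X j)) {C : ℝ} (hbdd : ∀ j ω, |X j ω| ≤ C) (hM : 0 ≤ M)
    (hc0 : ∀ i j, 0 ≤ cov μ (X i) (X j)) {r : ℕ} {K V : ℝ}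
    (hV : ∀ (i : ℕ) (J : Finset ℕ), ∑ j ∈ J, cov μ (X i) (X j) ≤ V)
    (hK : ∀ (a p : ℕ) (J : Finset ℕ), 1 ≤ p → (∀ j ∈ J, a + p ≤ j) →
      √(p : ℝ) ^ r * ∑ j ∈ J, cov μ (X a) (X j) ≤ K) :
    ∀ q ≤ r + 2, ∃ b, 0 ≤ b ∧ HasMomentBound μ X M q b := by
  have hV0 : 0 ≤ V := by simpa using hV 0 ∅
  have hK0 : 0 ≤ K := by simpa using hK 0 1 ∅ le_rfl (by simp)
  have h2 := hasMomentBound_two (M := M) hassoc hmeas hbdd hV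
  intro q
  induction q using Nat.strong_induction_on with
  | _ q ih =>
  intro hq
  match q with
  | 0 => exact ⟨1, zero_le_one, hasMomentBound_zero⟩
  | 1 => exact ⟨_, by positivity, h2.one_of_two hmeas⟩
  | 2 => exact ⟨V, hV0, h2⟩
  | q + 3 =>
    refine HasMomentBound.exists_add_two (r := q + 1) hassoc hmeas hbdd hM hc0 (by omega) hK0
      (fun a p J hp hJ => le_trans ?_ (hK a p J hp hJ)) fun i hi => ih i hi (by omega)
    have hS : 0 ≤ ∑ j ∈ J, cov μ (X a) (X j) := Finset.sum_nonneg fun _ _ => hc0 _ _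
    gcongr ?_ * _
    exact pow_le_pow_right₀ (Real.one_le_sqrt.2 (by exact_mod_cast hp)) (by omega)

end Blocks

lemma IsAssociated.comp_succ {μ : Measure Ω} {X : ℕ → Ω → ℝ} (hassoc : IsAssociated μ X) :
    IsAssociated μ fun j => X (j + 1) := by
  intro S h g hh hg hhm hgm
  set e : (S.map (addRightEmbedding 1) → ℝ) → S → ℝ := fun v i =>
    v ⟨i + 1, Finset.mem_map_of_mem (addRightEmbedding 1) i.2⟩
  have he : Monotone e := fun v w hvw i => hvw _
  have hem : Measurable e := measurable_pi_lambda _ fun i => measurable_pi_apply _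
  exact hassoc (S.map (addRightEmbedding 1)) (h ∘ e) (g ∘ e) (hh.comp he) (hg.comp he)
    (hhm.comp hem) (hgm.comp hem)

lemma cov_comm (μ : Measure Ω) (f g : Ω → ℝ) : cov μ f g = cov μ g f := by
  simp only [cov, mul_comm]

/-- Covariances of a stationary sequence only depend on the lag. -/
lemma StrictStationary.cov_eq {μ : Measure Ω} {X : ℕ → Ω → ℝ} (hstat : StrictStationary μ X)
    (hmeas : ∀ j, Measurable (X j)) (s l : ℕ) :
    cov μ (X (s + 1)) (X (s + l + 1)) = cov μ (X 1) (X (l + 1)) := by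
  have h := hstat s (l + 1)
  have hm : ∀ t, Measurable fun ω => fun i : Fin (l + 1) => X (1 + (i : ℕ) + t) ω :=
    fun t => measurable_pi_lambda _ fun i => hmeas _
  have key : ∀ F : (Fin (l + 1) → ℝ) → ℝ, Measurable F →
      ∫ ω, F (fun i => X (1 + (i : ℕ) + s) ω) ∂μ = ∫ ω, F (fun i => X (1 + (i : ℕ)) ω) ∂μ := by
    intro F hF
    rw [← integral_map (hm s).aemeasurable hF.aestronglyMeasurable, h]
    exact integral_map (hm 0).aemeasurable hF.aestronglyMeasurable
  have h0 := key (fun v => v 0) (by fun_prop)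
  have h1 := key (fun v => v (Fin.last l)) (by fun_prop)
  have h2 := key (fun v => v 0 * v (Fin.last l)) (by fun_prop)
  simp only [Fin.val_zero, Fin.val_last, add_zero] at h0 h1 h2
  simp only [cov]
  rw [show s + l + 1 = 1 + l + s by omega, show s + 1 = 1 + s by omega,
    show l + 1 = 1 + l by omega, h0, h1, h2]

lemma IsAssociated.cov_nonneg {μ : Measure Ω} [IsProbabilityMeasure μ]
    {X : ℕ → Ω → ℝ} (hassoc : IsAssociated μ X) (hmeas : ∀ j, Measurable (X j))
    {C : ℝ} (hbdd : ∀ j ω, |X j ω| ≤ C) (i j : ℕ) : 0 ≤ cov μ (X i) (X j) := by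
  have hi := memLp_two_of_abs_le (μ := μ) (hmeas i) C (hbdd i)
  have hj := memLp_two_of_abs_le (μ := μ) (hmeas j) C (hbdd j)
  rw [cov_eq_covariance hi hj]
  exact hassoc.covariance_nonneg {i, j} (F := fun a => a i) (G := fun a => a j)
    (fun a b h => h i) (fun a b h => h j) (measurable_pi_apply i) (measurable_pi_apply j)
    (fun a b h => h i (by simp)) (fun a b h => h j (by simp)) hi hj

lemma sum_comp_le_tsum_of_injOn {c : ℕ → ℝ} (hc : ∀ i, 0 ≤ c i) (hs : Summable c)
    {J : Finset ℕ} {φ : ℕ → ℕ} (hφ : Set.InjOn φ J) : ∑ j ∈ J, c (φ j) ≤ ∑' i, c i := by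
  rw [← Finset.sum_image (f := c) hφ]
  exact hs.sum_le_tsum _ fun i _ => hc i

/-- The centered distance to `x`, truncated outside `[-C, C]`, is a centered contraction. -/
lemma isCenteredContraction_abs_sub {μ : Measure Ω} [IsProbabilityMeasure μ]
    {X : ℕ → Ω → ℝ} (hmeas : ∀ j, Measurable (X j)) {C : ℝ} (hC : 0 ≤ C)
    (hbdd : ∀ j ω, |X j ω| ≤ C) {x : ℝ} (hx : |x| ≤ C) :
    IsCenteredContraction μ X (2 * C) fun j y =>
      |max (min y C) (-C) - x| - ∫ ω, |X j ω - x| ∂μ := by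
  have hx' := abs_le.1 hx
  have hdist : ∀ j ω, |X j ω - x| ≤ 2 * C := fun j ω =>
    (abs_sub _ _).trans (by linarith [hbdd j ω])
  have hint : ∀ j, Integrable (fun ω => |X j ω - x|) μ := fun j =>
    integrable_of_abs_le ((hmeas j).sub_const x).norm (2 * C) fun ω => by
      rw [abs_abs]
      exact hdist j ω
  refine ⟨fun j => by fun_prop, fun j a b => ?_, fun j a => ?_, fun j => ?_⟩
  · rw [sub_sub_sub_cancel_right]
    refine (abs_abs_sub_abs_le _ _).trans ?_
    rw [sub_sub_sub_cancel_right]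
    refine (abs_max_sub_max_le_abs _ _ _).trans ((abs_min_sub_min_le_max _ _ _ _).trans ?_)
    simp
  · have h1 : |max (min a C) (-C) - x| ≤ 2 * C := by
      have h2 : max (min a C) (-C) ≤ C := max_le (min_le_right _ _) (by linarith)
      have h3 := le_max_right (min a C) (-C)
      exact abs_le.2 ⟨by linarith, by linarith⟩
    have h4 : ∫ ω, |X j ω - x| ∂μ ≤ 2 * C := by
      simpa using integral_mono (hint j) (integrable_const (2 * C)) (hdist j)
    have h5 : 0 ≤ ∫ ω, |X j ω - x| ∂μ := integral_nonneg fun ω => abs_nonneg _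
    exact abs_le.2 ⟨by linarith [abs_nonneg (max (min a C) (-C) - x)], by linarith⟩
  · have h : ∀ ω, max (min (X j ω) C) (-C) = X j ω := fun ω => by
      rw [min_eq_left (abs_le.1 (hbdd j ω)).2, max_eq_left (abs_le.1 (hbdd j ω)).1]
    simp only [h]
    rw [integral_sub (hint j) (integrable_const _)]
    simp

/-- Uniform `k`-th moment bound for `S_n(x) = ∑_{j=1}^n (|X_j − x| − E|X_j − x|)`:
under the covariance decay `∑_{j=n+1}^∞ Cov(X₁, Xⱼ) = O(n^{−(k−2)/2})`, there is `B > 0`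
with `sup_{x ∈ [−C₁,C₁]} E|S_n(x)|^k ≤ B n^{k/2}` for all `n ≥ 1`. -/
theorem uniform_moment_bound (μ : Measure Ω) [IsProbabilityMeasure μ]
    (X : ℕ → Ω → ℝ) (hmeas : ∀ j, Measurable (X j))
    (hstat : StrictStationary μ X) (hassoc : IsAssociated μ X)
    (C₁ : ℝ) (hbdd : ∀ n : ℕ, 1 ≤ n → ∀ ω, |X n ω| ≤ C₁)
    (k : ℕ) (hk : 2 < k)
    (hsum : Summable fun j : ℕ => cov μ (X 1) (X (j + 2)))
    (hcov : ∃ K : ℝ, ∀ n : ℕ, 1 ≤ n →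
      ∑' i : ℕ, cov μ (X 1) (X (n + 1 + i)) ≤ K * (n : ℝ) ^ (-(((k : ℝ) - 2) / 2))) :
    ∃ B : ℝ, 0 < B ∧ ∀ n : ℕ, 1 ≤ n → ∀ x ∈ Set.Icc (-C₁) C₁,
      ∫ ω, |∑ j ∈ Finset.Icc 1 n, (|X j ω - x| - ∫ ω', |X j ω' - x| ∂μ)| ^ (k : ℝ) ∂μ ≤
        B * (n : ℝ) ^ ((k : ℝ) / 2) := by
  obtain ⟨K, hK⟩ := hcov
  obtain ⟨r, rfl⟩ : ∃ r, k = r + 2 := ⟨k - 2, by omega⟩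
  have hbdd' : ∀ j ω, |X (j + 1) ω| ≤ C₁ := fun j => hbdd (j + 1) (Nat.le_add_left 1 j)
  have hmeas' : ∀ j, Measurable (X (j + 1)) := fun j => hmeas _
  have hassoc' := hassoc.comp_succ
  obtain ⟨ω₀⟩ : Nonempty Ω := nonempty_of_isProbabilityMeasure μ
  have hC : 0 ≤ C₁ := (abs_nonneg _).trans (hbdd' 0 ω₀)
  have hc0 : ∀ i j, 0 ≤ cov μ (X (i + 1)) (X (j + 1)) := hassoc'.cov_nonneg hmeas' hbdd'
  set c : ℕ → ℝ := fun l => cov μ (X 1) (X (l + 1)) with hc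
  have hcs : Summable c := (summable_nat_add_iff 1).1 hsum
  have hcp : ∀ p, Summable fun i => c (p + i) := fun p => by
    simpa only [add_comm p] using (summable_nat_add_iff p).2 hcs
  have hlag : ∀ a j, a ≤ j → cov μ (X (a + 1)) (X (j + 1)) = c (j - a) := by
    intro a j haj
    obtain ⟨l, rfl⟩ := Nat.exists_eq_add_of_le haj
    rw [hstat.cov_eq hmeas, Nat.add_sub_cancel_left]
  have htail : ∀ (a p : ℕ) (J : Finset ℕ), (∀ j ∈ J, a + p ≤ j) →
      ∑ j ∈ J, cov μ (X (a + 1)) (X (j + 1)) ≤ ∑' i, c (p + i) := by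
    intro a p J hJ
    rw [Finset.sum_congr rfl fun j hj => show _ = c (p + (j - (a + p))) by
      have := hJ j hj
      rw [hlag a j (by omega)]
      congr 1
      omega]
    refine sum_comp_le_tsum_of_injOn (c := fun i => c (p + i)) (fun i => hc0 0 _) (hcp p) ?_
    intro i hi j hj hij
    have := hJ i hi
    have := hJ j hj
    simp only at hij
    omega
  have hV : ∀ (a : ℕ) (J : Finset ℕ),
      ∑ j ∈ J, cov μ (X (a + 1)) (X (j + 1)) ≤ ∑' i, c (0 + i) + ∑' i, c i := by
    intro a J
    rw [← Finset.sum_filter_add_sum_filter_not J (fun j => a ≤ j)]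
    refine add_le_add (htail a 0 _ fun j hj => (Finset.mem_filter.1 hj).2) ?_
    rw [Finset.sum_congr rfl fun j hj => show _ = c (a - j) by
      rw [cov_comm, hlag j a (le_of_not_ge (Finset.mem_filter.1 hj).2)]]
    refine sum_comp_le_tsum_of_injOn (fun i => hc0 0 _) hcs ?_
    intro i hi j hj hij
    simp only [Finset.coe_filter, Set.mem_ofPred_eq] at hi hj
    omega
  have hdecay : ∀ (a p : ℕ) (J : Finset ℕ), 1 ≤ p → (∀ j ∈ J, a + p ≤ j) →
      √(p : ℝ) ^ r * ∑ j ∈ J, cov μ (X (a + 1)) (X (j + 1)) ≤ K := by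
    intro a p J hp hJ
    have hp0 : 0 < √(p : ℝ) ^ r := pow_pos (Real.sqrt_pos.2 (by exact_mod_cast hp)) r
    have h1 : ∑' i, c (p + i) ≤ K * (√(p : ℝ) ^ r)⁻¹ := by
      have h2 := hK p hp
      rw [show ((r + 2 : ℕ) : ℝ) - 2 = r by push_cast; ring, Real.rpow_neg (Nat.cast_nonneg p),
        Real.rpow_div_two_eq_sqrt _ (Nat.cast_nonneg p), Real.rpow_natCast] at h2
      simpa only [hc, add_right_comm p] using h2
    calc _ ≤ √(p : ℝ) ^ r * (K * (√(p : ℝ) ^ r)⁻¹) := by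
          gcongr
          exact (htail a p J hJ).trans h1
      _ = K := by field_simp
  obtain ⟨b, hb0, hb⟩ := exists_hasMomentBound (M := 2 * C₁) hassoc' hmeas' hbdd'
    (by positivity) hc0 hV hdecay (r + 2) le_rfl
  refine ⟨b + 1, by positivity, fun n hn x hx => ?_⟩
  have hg := isCenteredContraction_abs_sub (μ := μ) hmeas' hC hbdd' (abs_le.2 hx)
  have hbn := hb _ hg 0 n
  have hclip : ∀ j ω, max (min (X (j + 1) ω) C₁) (-C₁) = X (j + 1) ω := fun j ω => by
    rw [min_eq_left (abs_le.1 (hbdd' j ω)).2, max_eq_left (abs_le.1 (hbdd' j ω)).1]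
  simp only [blockSum, hclip] at hbn
  have hshift : ∀ ω, ∑ j ∈ Finset.Ico 0 (0 + n), (|X (j + 1) ω - x| -
      ∫ ω', |X (j + 1) ω' - x| ∂μ) =
      ∑ j ∈ Finset.Icc 1 n, (|X j ω - x| - ∫ ω', |X j ω' - x| ∂μ) := fun ω => by
    rw [Finset.sum_Ico_add' (fun j => |X j ω - x| - ∫ ω', |X j ω' - x| ∂μ)]
    simp only [zero_add]
    rfl
  simp only [hshift] at hbn
  rw [Real.rpow_div_two_eq_sqrt _ (Nat.cast_nonneg n)]
  simp only [Real.rpow_natCast]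
  refine hbn.trans ?_
  gcongr
  linarith
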